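/- Let B = (A, {w_m}, {μ_m}) and B̂ = (A, {ŵ_m}, {μ̂_m}) be two LMAB instances with the same finite action set A, finite reward-value set Z ⊆ [−1,1], M latent contexts, and horizon H ≥ 1. Then for every history-dependent policy π and every coupling Γ of w and ŵ: Σ_{a_{1:H}∈A^H} Σ_{r_{1:H}∈Z^H} |Σ_{m=1}^M w_m Π_{t=1}^H μ_m(a_t,r_t) − Σ_{m=1}^M ŵ_m Π_{t=1}^H μ̂_m(a_t,r_t)| · Π_{t=1}^H π(a_t|a_{1:t−1},r_{1:t−1}) ≤ H · Σ_{(m,m')∈[M]²} Γ(m,m') · max_{a∈A} Σ_{z∈Z} |μ_m(a,z) − μ̂_{m'}(a,z)|. -/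

import Mathlib

open scoped BigOperators

/-- The prefix of length `t` of a length-`H` sequence. -/
def prefixFn {α : Type*} {H : ℕ} (a : Fin H → α) (t : Fin H) : Fin t.1 → α :=
  fun j => a ⟨j.1, j.2.trans t.2⟩

/-- A sum over sequences of length `n + 1` splits off the last entry. -/
theorem sum_snoc {α : Type*} [Fintype α] {n : ℕ} (f : (Fin (n + 1) → α) → ℝ) :
    ∑ a, f a = ∑ a : Fin n → α, ∑ x, f (Fin.snoc (α := fun _ => α) a x) := by
  rw [← (Fin.snocEquiv fun _ : Fin (n + 1) => α).sum_comp, Fintype.sum_prod_type_right]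
  rfl

theorem prefixFn_snoc_castSucc {α : Type*} {n : ℕ} (a : Fin n → α) (x : α) (t : Fin n) :
    prefixFn (Fin.snoc (α := fun _ => α) a x) t.castSucc = prefixFn a t := by
  funext j
  exact Fin.snoc_castSucc (α := fun _ => α) x a ⟨j.1, j.2.trans t.2⟩

theorem prefixFn_snoc_last {α : Type*} {n : ℕ} (a : Fin n → α) (x : α) :
    prefixFn (Fin.snoc (α := fun _ => α) a x) (Fin.last n) = a := by
  funext j
  exact Fin.snoc_castSucc (α := fun _ => α) x a j

/-- The product of the action probabilities of a policy along a trajectory. -/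
def policyWeight {A R : Type*} {H : ℕ}
    (π : (t : Fin H) → (Fin t.1 → A) → (Fin t.1 → R) → A → ℝ)
    (a : Fin H → A) (r : Fin H → R) : ℝ :=
  ∏ t, π t (prefixFn a t) (prefixFn r t) (a t)

theorem policyWeight_nonneg {A R : Type*} {H : ℕ}
    {π : (t : Fin H) → (Fin t.1 → A) → (Fin t.1 → R) → A → ℝ}
    (hπ0 : ∀ t h1 h2 a, 0 ≤ π t h1 h2 a) (a : Fin H → A) (r : Fin H → R) :
    0 ≤ policyWeight π a r :=
  Finset.prod_nonneg fun _ _ => hπ0 _ _ _ _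

theorem policyWeight_snoc {A R : Type*} {n : ℕ}
    (π : (t : Fin (n + 1)) → (Fin t.1 → A) → (Fin t.1 → R) → A → ℝ)
    (a : Fin n → A) (r : Fin n → R) (x : A) (z : R) :
    policyWeight π (Fin.snoc (α := fun _ => A) a x) (Fin.snoc (α := fun _ => R) r z) =
      policyWeight (fun t => π t.castSucc) a r * π (Fin.last n) a r x := by
  unfold policyWeight
  rw [Fin.prod_univ_castSucc]
  simp only [prefixFn_snoc_castSucc, prefixFn_snoc_last, Fin.snoc_castSucc, Fin.snoc_last]

/-- Trajectory sums over `n + 1` steps, with the last step innermost. -/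
theorem sum_sum_snoc {A R : Type*} [Fintype A] [Fintype R] {n : ℕ}
    (f : (Fin (n + 1) → A) → (Fin (n + 1) → R) → ℝ) :
    ∑ a, ∑ r, f a r = ∑ a : Fin n → A, ∑ r : Fin n → R, ∑ x, ∑ z,
      f (Fin.snoc (α := fun _ => A) a x) (Fin.snoc (α := fun _ => R) r z) := by
  rw [sum_snoc]
  refine Finset.sum_congr rfl fun a _ => ?_
  rw [Finset.sum_comm]
  simp only [sum_snoc]
  refine Finset.sum_congr rfl fun r _ => ?_
  rw [Finset.sum_comm]

theorem sum_prod_mul_policyWeight {A R : Type*} [Fintype A] [Fintype R] (q : A → R → ℝ)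
    (hq1 : ∀ a, ∑ z, q a z = 1) (H : ℕ)
    (π : (t : Fin H) → (Fin t.1 → A) → (Fin t.1 → R) → A → ℝ)
    (hπ1 : ∀ t h1 h2, ∑ a, π t h1 h2 a = 1) :
    ∑ a : Fin H → A, ∑ r : Fin H → R, (∏ t, q (a t) (r t)) * policyWeight π a r = 1 := by
  induction H with
  | zero => simp [policyWeight]
  | succ n ih =>
    rw [sum_sum_snoc, ← ih (fun t => π t.castSucc) fun t => hπ1 t.castSucc]
    refine Finset.sum_congr rfl fun a _ => Finset.sum_congr rfl fun r _ => ?_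
    simp only [policyWeight_snoc, Fin.prod_univ_castSucc, Fin.snoc_castSucc, Fin.snoc_last]
    set P := ∏ t, q (a t) (r t)
    set W := policyWeight (fun t => π t.castSucc) a r
    calc ∑ x, ∑ z, P * q x z * (W * π (Fin.last n) a r x)
        = ∑ x, P * W * π (Fin.last n) a r x * ∑ z, q x z := by
          simp only [Finset.mul_sum]
          exact Finset.sum_congr rfl fun x _ => Finset.sum_congr rfl fun z _ => by ring
      _ = P * W * ∑ x, π (Fin.last n) a r x := by
          simp only [hq1, mul_one, Finset.mul_sum]
      _ = P * W := by
          have h := hπ1 (Fin.last n) a r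
          rw [h, mul_one]

/-- The trajectory laws of two reward kernels under one policy differ by at most `H` times the
largest one-step difference. -/
theorem sum_abs_prod_sub_prod_mul_policyWeight_le {A R : Type*} [Fintype A] [Fintype R]
    (p q : A → R → ℝ) (hp0 : ∀ a z, 0 ≤ p a z) (hq0 : ∀ a z, 0 ≤ q a z)
    (hp1 : ∀ a, ∑ z, p a z = 1) (hq1 : ∀ a, ∑ z, q a z = 1)
    (D : ℝ) (hD : ∀ a, ∑ z, |p a z - q a z| ≤ D) (H : ℕ)
    (π : (t : Fin H) → (Fin t.1 → A) → (Fin t.1 → R) → A → ℝ)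
    (hπ0 : ∀ t h1 h2 a, 0 ≤ π t h1 h2 a)
    (hπ1 : ∀ t h1 h2, ∑ a, π t h1 h2 a = 1) :
    ∑ a : Fin H → A, ∑ r : Fin H → R,
      |∏ t, p (a t) (r t) - ∏ t, q (a t) (r t)| * policyWeight π a r ≤ H * D := by
  induction H with
  | zero => simp
  | succ n ih =>
    have ih' := ih (fun t => π t.castSucc) (fun t => hπ0 t.castSucc) fun t => hπ1 t.castSucc
    have hmass := sum_prod_mul_policyWeight q hq1 n (fun t => π t.castSucc)
      fun t => hπ1 t.castSucc
    rw [sum_sum_snoc]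
    have step : ∀ (a : Fin n → A) (r : Fin n → R),
        ∑ x, ∑ z, |∏ t, p (Fin.snoc (α := fun _ => A) a x t) (Fin.snoc (α := fun _ => R) r z t) -
            ∏ t, q (Fin.snoc (α := fun _ => A) a x t) (Fin.snoc (α := fun _ => R) r z t)| *
          policyWeight π (Fin.snoc (α := fun _ => A) a x) (Fin.snoc (α := fun _ => R) r z) ≤
        |∏ t, p (a t) (r t) - ∏ t, q (a t) (r t)| * policyWeight (fun t => π t.castSucc) a r +
          D * ((∏ t, q (a t) (r t)) * policyWeight (fun t => π t.castSucc) a r) := by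
      intro a r
      simp only [policyWeight_snoc, Fin.prod_univ_castSucc, Fin.snoc_castSucc, Fin.snoc_last]
      have hW : 0 ≤ policyWeight (fun t => π t.castSucc) a r :=
        policyWeight_nonneg (fun t => hπ0 t.castSucc) a r
      have hQ : 0 ≤ ∏ t, q (a t) (r t) := Finset.prod_nonneg fun _ _ => hq0 _ _
      have hl0 : ∀ x, 0 ≤ π (Fin.last n) a r x := hπ0 (Fin.last n) a r
      have hl1 : ∑ x, π (Fin.last n) a r x = 1 := hπ1 (Fin.last n) a r
      set P := ∏ t, p (a t) (r t)
      set Q := ∏ t, q (a t) (r t)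
      set W := policyWeight (fun t => π t.castSucc) a r
      have one_step : ∀ x, ∑ z, |P * p x z - Q * q x z| ≤ |P - Q| + Q * D := by
        intro x
        calc ∑ z, |P * p x z - Q * q x z|
            ≤ ∑ z, (|P - Q| * p x z + Q * |p x z - q x z|) := by
              refine Finset.sum_le_sum fun z _ => ?_
              have h : P * p x z - Q * q x z = (P - Q) * p x z + Q * (p x z - q x z) := by ring
              rw [h]
              refine (abs_add_le _ _).trans_eq ?_
              rw [abs_mul, abs_mul, abs_of_nonneg (hp0 x z), abs_of_nonneg hQ]
          _ = |P - Q| + Q * ∑ z, |p x z - q x z| := by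
              rw [Finset.sum_add_distrib, ← Finset.mul_sum, ← Finset.mul_sum, hp1, mul_one]
          _ ≤ |P - Q| + Q * D := by gcongr; exact hD x
      calc ∑ x, ∑ z, |P * p x z - Q * q x z| * (W * π (Fin.last n) a r x)
          = ∑ x, (∑ z, |P * p x z - Q * q x z|) * (W * π (Fin.last n) a r x) := by
            simp only [Finset.sum_mul]
        _ ≤ ∑ x, (|P - Q| + Q * D) * (W * π (Fin.last n) a r x) :=
            Finset.sum_le_sum fun x _ =>
              mul_le_mul_of_nonneg_right (one_step x) (mul_nonneg hW (hl0 x))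
        _ = (|P - Q| + Q * D) * (W * ∑ x, π (Fin.last n) a r x) := by
            simp only [Finset.mul_sum]
        _ = |P - Q| * W + D * (Q * W) := by rw [hl1]; ring
    refine (Finset.sum_le_sum fun a _ => Finset.sum_le_sum fun r _ => step a r).trans ?_
    simp only [Finset.sum_add_distrib, ← Finset.mul_sum, hmass]
    push_cast
    linarith

/-- A coupling rewrites a difference of mixtures as a mixture of differences. -/
theorem abs_sum_sub_sum_le_of_coupling {ι : Type*} [Fintype ι] {w wh : ι → ℝ} {Γ : ι → ι → ℝ}
    (hΓ0 : ∀ m m', 0 ≤ Γ m m') (hΓw : ∀ m, ∑ m', Γ m m' = w m)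
    (hΓwh : ∀ m', ∑ m, Γ m m' = wh m') (P Q : ι → ℝ) :
    |∑ m, w m * P m - ∑ m, wh m * Q m| ≤ ∑ m, ∑ m', Γ m m' * |P m - Q m'| := by
  have h : ∑ m, w m * P m - ∑ m, wh m * Q m = ∑ m, ∑ m', Γ m m' * (P m - Q m') := by
    simp only [mul_sub, Finset.sum_sub_distrib, ← hΓw, ← hΓwh, Finset.sum_mul]
    congr 1
    exact Finset.sum_comm
  rw [h]
  refine (Finset.abs_sum_le_sum_abs _ _).trans (Finset.sum_le_sum fun m _ => ?_)
  refine (Finset.abs_sum_le_sum_abs _ _).trans_eq (Finset.sum_congr rfl fun m' _ => ?_)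
  rw [abs_mul, abs_of_nonneg (hΓ0 m m')]

theorem stmt10 (A : Type*) [Fintype A] [Nonempty A]
    (Z : Finset ℝ) (hZ : ∀ z ∈ Z, |z| ≤ 1)
    (M H : ℕ) (hH : 1 ≤ H)
    (w wh : Fin M → ℝ) (hw0 : ∀ m, 0 ≤ w m) (hwh0 : ∀ m, 0 ≤ wh m)
    (hw1 : ∑ m, w m = 1) (hwh1 : ∑ m, wh m = 1)
    (μ μh : Fin M → A → {z // z ∈ Z} → ℝ)
    (hμ0 : ∀ m a z, 0 ≤ μ m a z) (hμh0 : ∀ m a z, 0 ≤ μh m a z)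
    (hμ1 : ∀ m a, ∑ z, μ m a z = 1) (hμh1 : ∀ m a, ∑ z, μh m a z = 1)
    (π : (t : Fin H) → (Fin t.1 → A) → (Fin t.1 → {z // z ∈ Z}) → A → ℝ)
    (hπ0 : ∀ t h1 h2 a, 0 ≤ π t h1 h2 a)
    (hπ1 : ∀ t h1 h2, ∑ a, π t h1 h2 a = 1)
    (Γ : Fin M → Fin M → ℝ) (hΓ0 : ∀ m m', 0 ≤ Γ m m')
    (hΓw : ∀ m, ∑ m', Γ m m' = w m) (hΓwh : ∀ m', ∑ m, Γ m m' = wh m') :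
    ∑ a : Fin H → A, ∑ r : Fin H → {z // z ∈ Z},
        |∑ m, w m * ∏ t, μ m (a t) (r t) -
            ∑ m, wh m * ∏ t, μh m (a t) (r t)| *
          ∏ t, π t (prefixFn a t) (prefixFn r t) (a t) ≤
      (H : ℝ) * ∑ m, ∑ m', Γ m m' *
        (Finset.univ.sup' Finset.univ_nonempty
          fun a : A => ∑ z, |μ m a z - μh m' a z|) := by
  calc
    _ ≤ ∑ a : Fin H → A, ∑ r : Fin H → {z // z ∈ Z}, ∑ m, ∑ m', Γ m m' *
          (|∏ t, μ m (a t) (r t) - ∏ t, μh m' (a t) (r t)| * policyWeight π a r) := by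
      refine Finset.sum_le_sum fun a _ => Finset.sum_le_sum fun r _ => ?_
      refine (mul_le_mul_of_nonneg_right (abs_sum_sub_sum_le_of_coupling hΓ0 hΓw hΓwh _ _)
        (policyWeight_nonneg hπ0 a r)).trans_eq ?_
      simp only [Finset.sum_mul, mul_assoc]
    _ = ∑ m, ∑ m', Γ m m' * ∑ a : Fin H → A, ∑ r : Fin H → {z // z ∈ Z},
          |∏ t, μ m (a t) (r t) - ∏ t, μh m' (a t) (r t)| * policyWeight π a r := by
      simp only [Finset.mul_sum]
      simp only [Finset.sum_comm (s := (Finset.univ : Finset (Fin H → {z // z ∈ Z})))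
        (t := (Finset.univ : Finset (Fin M)))]
      simp only [Finset.sum_comm (s := (Finset.univ : Finset (Fin H → A)))
        (t := (Finset.univ : Finset (Fin M)))]
    _ ≤ ∑ m, ∑ m', Γ m m' * (H * Finset.univ.sup' Finset.univ_nonempty
          fun a : A => ∑ z, |μ m a z - μh m' a z|) := by
      refine Finset.sum_le_sum fun m _ => Finset.sum_le_sum fun m' _ =>
        mul_le_mul_of_nonneg_left ?_ (hΓ0 m m')
      exact sum_abs_prod_sub_prod_mul_policyWeight_le (μ m) (μh m') (hμ0 m) (hμh0 m')
        (hμ1 m) (hμh1 m') _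
        (fun a => Finset.le_sup' (fun a : A => ∑ z, |μ m a z - μh m' a z|) (Finset.mem_univ a))
        H π hπ0 hπ1
    _ = _ := by
      simp only [Finset.mul_sum]
      exact Finset.sum_congr rfl fun m _ => Finset.sum_congr rfl fun m' _ => mul_left_comm _ _ _
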